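/- Let $\beta\in\{1,2\}$ and let $r\geq\beta$ be an integer. Let $x\in[0,1]^N$ and let $q\in\mathbb{R}^N$ satisfy $\|D^{-r}(x-q)\|_\infty\leq\delta/2$ for some $\delta>0$. Let $\hat{x}$ be any minimizer of $\|(D^{\beta})^T z\|_1$ over all $z\in\mathbb{R}^N$ with $\|D^{-r}(z-q)\|_\infty\leq\delta/2$. Then for every integer $1\leq s\leq N$, $\|\hat{x}-x\|_2\leq C\left(\sqrt{s}\,\delta+\sqrt{\sigma_s((D^{\beta})^T x)\,\delta}\right)$, where $\sigma_s(v)=\min\{\|v-w\|_1 : w \text{ is } s\text{-sparse}\}$ is the best $s$-term $\ell_1$ approximation error, and $C$ is a constant depending only on $r$ (explicitly, $\|\hat{x}-x\|_2^2\leq 2^{2r+1}s\delta^2+2^{r-\beta+1}\sigma_s((D^{\beta})^T x)\,\delta$). -/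

import Mathlib

open scoped BigOperators
open Finset Matrix

/-- The `N × N` finite difference matrix with `1`s on the diagonal and `-1`s on
the subdiagonal. -/
noncomputable def Dmat (N : ℕ) : Matrix (Fin N) (Fin N) ℝ :=
  Matrix.of fun i j => if i = j then 1 else if (j : ℕ) + 1 = (i : ℕ) then -1 else 0

/-- Entrywise ℓ¹ norm of a vector. -/
noncomputable def l1 {N : ℕ} (v : Fin N → ℝ) : ℝ := ∑ i, |v i|

/-- Euclidean norm of a vector. -/
noncomputable def l2 {N : ℕ} (v : Fin N → ℝ) : ℝ := Real.sqrt (∑ i, (v i) ^ 2)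

/-- Number of nonzero entries of a vector (the "ℓ⁰ norm"). -/
noncomputable def sparsity {N : ℕ} (v : Fin N → ℝ) : ℕ :=
  (Finset.univ.filter (fun i => v i ≠ 0)).card

/-- `σ_s(v)`: the best `s`-term ℓ¹ approximation error of `v`. -/
noncomputable def sigmaTail {N : ℕ} (s : ℕ) (v : Fin N → ℝ) : ℝ :=
  sInf {t : ℝ | ∃ w : Fin N → ℝ, sparsity w ≤ s ∧ t = l1 (v - w)}

lemma Dmat_det (N : ℕ) : (Dmat N).det = 1 := by
  rw [Matrix.det_of_isLowerTriangular]
  · simp [Dmat]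
  · intro i j hij
    have hij' : i < j := hij
    have h1 : i ≠ j := ne_of_lt hij'
    have h2 : ¬ ((j : ℕ) + 1 = (i : ℕ)) := by
      have : (i : ℕ) < j := hij'
      omega
    simp [Dmat, h1, h2]

lemma Dmat_entry_le {N : ℕ} (i j : Fin N) :
    |Dmat N i j| ≤ (if i = j then 1 else 0) + (if (j : ℕ) + 1 = (i : ℕ) then 1 else 0) := by
  unfold Dmat
  simp only [Matrix.of_apply]
  split_ifs <;> norm_num

lemma sum_ite_le_one {N : ℕ} (p : Fin N → Prop) [DecidablePred p]
    (hp : ∀ a b, p a → p b → a = b) : ∑ j, (if p j then (1 : ℝ) else 0) ≤ 1 := by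
  rw [Finset.sum_boole]
  have : (Finset.univ.filter p).card ≤ 1 := by
    rw [Finset.card_le_one]
    intro a ha b hb
    exact hp a b (by simpa using ha) (by simpa using hb)
  exact_mod_cast this

lemma mulVec_bound {N : ℕ} (A : Matrix (Fin N) (Fin N) ℝ) (hA : ∀ i, ∑ j, |A i j| ≤ 2)
    (v : Fin N → ℝ) (M : ℝ) (hv : ∀ i, |v i| ≤ M) (i : Fin N) :
    |(A.mulVec v) i| ≤ 2 * M := by
  have hM : 0 ≤ M := (abs_nonneg _).trans (hv i)
  calc |(A.mulVec v) i| = |∑ j, A i j * v j| := rfl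
    _ ≤ ∑ j, |A i j * v j| := Finset.abs_sum_le_sum_abs _ _
    _ ≤ ∑ j, |A i j| * M := by
        refine Finset.sum_le_sum fun j _ => ?_
        rw [abs_mul]
        exact mul_le_mul_of_nonneg_left (hv j) (abs_nonneg _)
    _ = (∑ j, |A i j|) * M := by rw [Finset.sum_mul]
    _ ≤ 2 * M := mul_le_mul_of_nonneg_right (hA i) hM

lemma pow_mulVec_bound {N : ℕ} (A : Matrix (Fin N) (Fin N) ℝ) (hA : ∀ i, ∑ j, |A i j| ≤ 2)
    (v : Fin N → ℝ) (M : ℝ) (hv : ∀ i, |v i| ≤ M) (k : ℕ) :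
    ∀ i, |((A ^ k).mulVec v) i| ≤ 2 ^ k * M := by
  induction k with
  | zero => simpa using hv
  | succ k ih =>
    intro i
    rw [pow_succ', ← Matrix.mulVec_mulVec]
    have := mulVec_bound A hA _ _ ih i
    rw [pow_succ]
    linarith

lemma Dmat_row {N : ℕ} (i : Fin N) : ∑ j, |Dmat N i j| ≤ 2 := by
  have h := Finset.sum_le_sum (s := Finset.univ) fun j _ => Dmat_entry_le i j
  rw [Finset.sum_add_distrib] at h
  have h1 := sum_ite_le_one (fun j : Fin N => i = j) (fun a b ha hb => ha.symm.trans hb)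
  have h2 := sum_ite_le_one (fun j : Fin N => (j : ℕ) + 1 = (i : ℕ))
    (fun a b ha hb => by apply Fin.ext; omega)
  linarith

lemma Dmat_col {N : ℕ} (i : Fin N) : ∑ j, |(Dmat N)ᵀ i j| ≤ 2 := by
  have h := Finset.sum_le_sum (s := Finset.univ) fun j _ => Dmat_entry_le j i
  rw [Finset.sum_add_distrib] at h
  have h1 := sum_ite_le_one (fun j : Fin N => j = i) (fun a b ha hb => ha.trans hb.symm)
  have h2 := sum_ite_le_one (fun j : Fin N => (i : ℕ) + 1 = (j : ℕ))
    (fun a b ha hb => by apply Fin.ext; omega)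
  simp only [Matrix.transpose_apply]
  linarith

lemma l1_cone {N : ℕ} (v e w : Fin N → ℝ) (M : ℝ) (hM : ∀ i, |e i| ≤ M)
    (h : l1 (v + e) ≤ l1 v) : l1 e ≤ 2 * M * sparsity w + 2 * l1 (v - w) := by
  have key : ∀ i, |e i| ≤ |(v + e) i| - |v i| + 2 * |(v - w) i|
      + 2 * M * (if w i ≠ 0 then 1 else 0) := by
    intro i
    simp only [Pi.add_apply, Pi.sub_apply]
    have h1 : |v i| ≤ |v i + e i| + |e i| := by
      have := abs_sub (v i + e i) (e i)
      simpa using this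
    have h2 : |e i| ≤ |v i + e i| + |v i| := by
      have := abs_sub (v i + e i) (v i)
      simpa using this
    by_cases hw : w i = 0
    · simp [hw]; linarith
    · simp [hw]; linarith [hM i, abs_nonneg (v i - w i)]
  have hs := Finset.sum_le_sum (s := Finset.univ) fun i _ => key i
  simp only [Finset.sum_add_distrib, Finset.sum_sub_distrib, ← Finset.mul_sum,
    Finset.sum_boole] at hs
  unfold l1 at *
  unfold sparsity
  linarith

/-- instance-optimal error bound
`‖x̂-x‖₂² ≤ 2^{2r+1} s δ² + 2^{r-β+1} σ_s((D^β)ᵀ x) δ` for the TV decoder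
applied to an `r`-th order Sigma Delta quantization of an arbitrary `x ∈ [0,1]^N`. -/
theorem sigma_delta_tv_decoder_error_compressible
    (N β r : ℕ) (hβ : β = 1 ∨ β = 2) (hβr : β ≤ r)
    (δ : ℝ) (hδ : 0 < δ)
    (x q : Fin N → ℝ)
    (hx : ∀ i, x i ∈ Set.Icc (0 : ℝ) 1)
    (hxfeas : ∀ i, |(((Dmat N)⁻¹ ^ r).mulVec (x - q)) i| ≤ δ / 2)
    (xhat : Fin N → ℝ)
    (hxhatfeas : ∀ i, |(((Dmat N)⁻¹ ^ r).mulVec (xhat - q)) i| ≤ δ / 2)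
    (hmin : ∀ z : Fin N → ℝ,
      (∀ i, |(((Dmat N)⁻¹ ^ r).mulVec (z - q)) i| ≤ δ / 2) →
      l1 (((Dmat N ^ β)ᵀ).mulVec xhat) ≤ l1 (((Dmat N ^ β)ᵀ).mulVec z)) :
    ∀ s : ℕ, 1 ≤ s → s ≤ N →
      (l2 (xhat - x)) ^ 2 ≤
        2 ^ (2 * r + 1) * s * δ ^ 2 +
          2 ^ (r - β + 1) * sigmaTail s (((Dmat N ^ β)ᵀ).mulVec x) * δ := by
  intro s _ _
  have hu : IsUnit (Dmat N).det := by rw [Dmat_det]; exact isUnit_one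
  have hinv : Dmat N ^ r * (Dmat N)⁻¹ ^ r = 1 := by
    rw [Matrix.inv_pow']
    exact Matrix.mul_nonsing_inv _ (by rw [Matrix.det_pow]; exact hu.pow r)
  set h : Fin N → ℝ := xhat - x with hh
  set u : Fin N → ℝ := ((Dmat N)⁻¹ ^ r).mulVec h with hudef
  have hub : ∀ i, |u i| ≤ δ := by
    intro i
    have e1 : u = ((Dmat N)⁻¹ ^ r).mulVec (xhat - q) - ((Dmat N)⁻¹ ^ r).mulVec (x - q) := by
      rw [← Matrix.mulVec_sub, hudef, hh]; congr 1; abel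
    rw [e1, Pi.sub_apply]
    refine (abs_sub _ _).trans ?_
    linarith [hxfeas i, hxhatfeas i]
  have hDu : (Dmat N ^ r).mulVec u = h := by
    rw [hudef, Matrix.mulVec_mulVec, hinv, Matrix.one_mulVec]
  set g : Fin N → ℝ := (Dmat N ^ (r - β)).mulVec u with hg
  have hgb : ∀ i, |g i| ≤ 2 ^ (r - β) * δ := pow_mulVec_bound _ Dmat_row u δ hub _
  have hDg : (Dmat N ^ β).mulVec g = h := by
    rw [hg, Matrix.mulVec_mulVec, ← pow_add, Nat.add_sub_cancel' hβr, hDu]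
  set e : Fin N → ℝ := ((Dmat N ^ β)ᵀ).mulVec h with he
  set v : Fin N → ℝ := ((Dmat N ^ β)ᵀ).mulVec x with hv
  have hhb : ∀ i, |h i| ≤ 2 ^ r * δ := by
    rw [← hDu]; exact pow_mulVec_bound _ Dmat_row u δ hub _
  have heb : ∀ i, |e i| ≤ 2 ^ β * (2 ^ r * δ) := by
    rw [he, Matrix.transpose_pow]
    exact pow_mulVec_bound _ Dmat_col h _ hhb _
  have hve : v + e = ((Dmat N ^ β)ᵀ).mulVec xhat := by
    rw [hv, he, ← Matrix.mulVec_add, hh]; congr 1; abel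
  have hle : l1 (v + e) ≤ l1 v := by rw [hve]; exact hmin x hxfeas
  have hsq : (l2 h) ^ 2 ≤ l1 e * (2 ^ (r - β) * δ) := by
    unfold l2 l1
    rw [Real.sq_sqrt (Finset.sum_nonneg fun i _ => sq_nonneg _)]
    have e1 : ∑ i, (h i) ^ 2 = e ⬝ᵥ g := by
      rw [he, Matrix.mulVec_transpose, ← Matrix.dotProduct_mulVec, hDg]
      simp [dotProduct, sq]
    rw [e1, dotProduct, Finset.sum_mul]
    refine Finset.sum_le_sum fun i _ => ?_
    refine (le_abs_self _).trans ?_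
    rw [abs_mul]
    exact mul_le_mul_of_nonneg_left (hgb i) (abs_nonneg _)
  have hK : (0 : ℝ) < 2 ^ (r - β + 1) * δ := by positivity
  have hpow : (2 : ℝ) ^ r = 2 ^ (r - β) * 2 ^ β := by
    rw [← pow_add, Nat.sub_add_cancel hβr]
  have hfin : ((l2 h) ^ 2 - 2 ^ (2 * r + 1) * s * δ ^ 2) / (2 ^ (r - β + 1) * δ)
      ≤ sigmaTail s v := by
    unfold sigmaTail
    refine le_csInf ⟨_, 0, by simp [sparsity], rfl⟩ ?_
    rintro t ⟨w, hw, rfl⟩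
    rw [div_le_iff₀ hK]
    have hc := l1_cone v e w _ heb hle
    have hw' : (sparsity w : ℝ) ≤ s := by exact_mod_cast hw
    have hc2 : l1 e ≤ 2 * (2 ^ β * (2 ^ r * δ)) * s + 2 * l1 (v - w) := by
      refine hc.trans ?_
      gcongr
    have h3 := hsq.trans (mul_le_mul_of_nonneg_right hc2
      (by positivity : (0 : ℝ) ≤ 2 ^ (r - β) * δ))
    have e2 : (2 : ℝ) ^ (2 * r + 1) = 2 * (2 ^ r * (2 ^ (r - β) * 2 ^ β)) := by
      rw [← hpow]; ring
    rw [e2, pow_succ (2 : ℝ) (r - β)]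
    linarith
  rw [div_le_iff₀ hK] at hfin
  linarith
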